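/- arXiv:2504.16887 — 2 statements merged into one kernel-verified Lean document; each statement's English description precedes it below -/
import Mathlib

section
/- Let r and c be positive integers and n = r + c. The probability over a uniformly random permutation π of (Fin n → Bool) that there exist x₁, x₂ ∈ (Fin r → Bool) with |{z ∈ (Fin c → Bool) : the first r bits of π(x₁ ∥ z) equal x₂}| ≥ 7·(2^c · 2^c / 2^{r+c}) + 3·(r+c) is at most 2^{−(r+c)}. In particular, at least a 1 − 2^{−n} fraction of permutations π of n-bit strings have the property that for all x₁, x₂ ∈ (Fin r → Bool), the number of suffixes z ∈ (Fin c → Bool) with π(x₁ ∥ z) beginning with x₂ is less than 7·2^{c−r} + 3n (as a real-valued threshold). -/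
open Finset in
/-- Among the permutations mapping `S` into `B`, the fraction that also map `a ∉ S` into `B` is
`(#B - #S) / (#α - #S)`. -/
theorem card_perm_mapsTo_insert {α : Type*} [Fintype α] [DecidableEq α] (S B : Finset α) {a : α}
    (ha : a ∉ S) :
    ((Fintype.card α : ℝ) - #S) * #{π : Equiv.Perm α | ∀ x ∈ insert a S, π x ∈ B} =
      ((#B : ℝ) - #S) * #{π : Equiv.Perm α | ∀ x ∈ S, π x ∈ B} := by
  have swap_count : ∀ b ∈ Sᶜ, #{π : Equiv.Perm α | ∀ x ∈ insert b S, π x ∈ B} =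
      #{π : Equiv.Perm α | ∀ x ∈ insert a S, π x ∈ B} := by
    intro b hb
    have hb : b ∉ S := by simpa using hb
    refine Finset.card_equiv (Equiv.mulRight (Equiv.swap a b)) fun π => ?_
    have hS : ∀ x ∈ S, Equiv.swap a b x = x := fun x hx =>
      Equiv.swap_apply_of_ne_of_ne (fun h => ha (h ▸ hx)) (fun h => hb (h ▸ hx))
    simp only [mem_filter, mem_univ, true_and, forall_mem_insert, Equiv.coe_mulRight,
      Equiv.Perm.mul_apply, Equiv.swap_apply_left]
    refine and_congr_right fun _ => forall₂_congr fun x hx => ?_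
    rw [hS x hx]
  have point_count : ∀ π ∈ ({π : Equiv.Perm α | ∀ x ∈ S, π x ∈ B} : Finset _),
      (#{b ∈ Sᶜ | π b ∈ B} : ℝ) = (#B : ℝ) - #S := by
    intro π hπ
    have hπ : ∀ x ∈ S, π x ∈ B := by simpa using hπ
    have h_union : #S + #{b ∈ Sᶜ | π b ∈ B} = #B := by
      rw [← card_union_of_disjoint]
      · refine Finset.card_equiv π fun x => ?_
        by_cases hx : x ∈ S <;> simp [hx, hπ]
      · exact disjoint_compl_right.mono_right (filter_subset _ _)
    rw [← h_union]
    push_cast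
    ring
  have double_count := sum_card_bipartiteAbove_eq_sum_card_bipartiteBelow
    (s := ({π : Equiv.Perm α | ∀ x ∈ S, π x ∈ B} : Finset _)) (t := Sᶜ)
    (fun π b => π b ∈ B)
  have hbelow : ∀ b ∈ Sᶜ, #(bipartiteBelow (fun (π : Equiv.Perm α) b => π b ∈ B)
      ({π : Equiv.Perm α | ∀ x ∈ S, π x ∈ B} : Finset _) b) =
      #{π : Equiv.Perm α | ∀ x ∈ insert a S, π x ∈ B} := by
    intro b hb
    rw [← swap_count b hb, bipartiteBelow, filter_filter]
    congr 1
    ext π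
    simp [and_comm]
  rw [sum_congr rfl hbelow, sum_const, smul_eq_mul] at double_count
  have double_count' := congrArg (Nat.cast (R := ℝ)) double_count
  push_cast at double_count'
  rw [card_compl, Nat.cast_sub (card_le_univ S)] at double_count'
  rw [← double_count']
  simp only [bipartiteAbove]
  rw [sum_congr rfl point_count, sum_const, nsmul_eq_mul, mul_comm]

open Finset in
/-- A uniformly random permutation maps `S` into `B` with probability at most `(#B / #α) ^ #S`. -/
theorem card_perm_mapsTo_le {α : Type*} [Fintype α] [DecidableEq α] (S B : Finset α) :
    (#{π : Equiv.Perm α | ∀ x ∈ S, π x ∈ B} : ℝ) ≤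
      (Fintype.card α).factorial * ((#B : ℝ) / Fintype.card α) ^ #S := by
  induction S using Finset.induction_on with
  | empty => simp [Fintype.card_perm]
  | insert a S ha ih =>
    have h := card_perm_mapsTo_insert S B ha
    rw [card_insert_of_notMem ha, pow_succ, ← mul_assoc]
    set G : ℝ := ((#{π : Equiv.Perm α | ∀ x ∈ S, π x ∈ B} : ℕ) : ℝ)
    set G' : ℝ := ((#{π : Equiv.Perm α | ∀ x ∈ insert a S, π x ∈ B} : ℕ) : ℝ)
    have hG : 0 ≤ G := Nat.cast_nonneg _
    have hSN : (#S : ℝ) < Fintype.card α := by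
      exact_mod_cast card_lt_univ_of_notMem ha
    have hBN : (#B : ℝ) ≤ Fintype.card α := by exact_mod_cast card_le_univ B
    have hS : (0 : ℝ) ≤ #S := Nat.cast_nonneg _
    have hN : (0 : ℝ) < Fintype.card α := hS.trans_lt hSN
    refine le_trans ?_ (mul_le_mul_of_nonneg_right ih (by positivity))
    rw [← mul_div_assoc, le_div_iff₀ hN]
    refine le_of_mul_le_mul_left ?_ (sub_pos.2 hSN)
    have hprod := mul_nonneg (mul_nonneg hS hG) (sub_nonneg.2 hBN)
    linear_combination (Fintype.card α : ℝ) * h + hprod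

open Finset in
/-- Exponential moment bound for the number of points of `A` that a uniformly random permutation
maps into `B`. -/
theorem sum_perm_two_pow_card_le {α : Type*} [Fintype α] [DecidableEq α] (A B : Finset α) :
    ∑ π : Equiv.Perm α, (2 : ℝ) ^ #{x ∈ A | π x ∈ B} ≤
      (Fintype.card α).factorial * Real.exp ((#A : ℝ) * #B / Fintype.card α) := by
  have hpow : ∀ π : Equiv.Perm α, (2 : ℝ) ^ #{x ∈ A | π x ∈ B} =
      ∑ S ∈ A.powerset, if ∀ x ∈ S, π x ∈ B then (1 : ℝ) else 0 := by
    intro π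
    rw [sum_boole]
    have : {S ∈ A.powerset | ∀ x ∈ S, π x ∈ B} = ({x ∈ A | π x ∈ B} : Finset α).powerset := by
      ext S
      simp only [mem_filter, mem_powerset, subset_iff, forall_and]
    rw [this, card_powerset]
    norm_num
  simp only [hpow]
  rw [sum_comm]
  simp only [sum_boole]
  calc _ ≤ ∑ S ∈ A.powerset,
        ((Fintype.card α).factorial : ℝ) * ((#B : ℝ) / Fintype.card α) ^ #S :=
        sum_le_sum fun S _ => card_perm_mapsTo_le S B
    _ = (Fintype.card α).factorial * ((#B : ℝ) / Fintype.card α + 1) ^ #A := by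
        rw [← mul_sum, ← sum_pow_mul_eq_add_pow]
        simp
    _ ≤ (Fintype.card α).factorial * Real.exp ((#B : ℝ) / Fintype.card α) ^ #A := by
        gcongr
        exact Real.add_one_le_exp _
    _ = _ := by
        rw [← Real.exp_nat_mul, mul_div_assoc]

open Finset in
/-- Tail bound for the number of points of `A` that a uniformly random permutation maps
into `B`. -/
theorem card_perm_le_card_filter_le {α : Type*} [Fintype α] [DecidableEq α] (A B : Finset α)
    (m : ℕ) :
    (#{π : Equiv.Perm α | 7 * ((#A : ℝ) * #B / Fintype.card α) + m ≤ #{x ∈ A | π x ∈ B}} : ℝ) ≤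
      (Fintype.card α).factorial / 2 ^ m := by
  set μ : ℝ := (#A : ℝ) * #B / Fintype.card α
  have hμ0 : 0 ≤ μ := by positivity
  set T : Finset (Equiv.Perm α) := {π | 7 * μ + m ≤ #{x ∈ A | π x ∈ B}}
  have markov : (#T : ℝ) * (2 : ℝ) ^ (7 * μ + m) ≤
      (Fintype.card α).factorial * Real.exp μ := by
    refine le_trans ?_ (sum_perm_two_pow_card_le A B)
    refine le_trans ?_ (sum_le_sum_of_subset_of_nonneg (subset_univ T)
      fun _ _ _ => by positivity)
    rw [← nsmul_eq_mul]
    refine card_nsmul_le_sum _ _ _ fun π hπ => ?_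
    rw [← Real.rpow_natCast]
    exact Real.rpow_le_rpow_of_exponent_le one_le_two (mem_filter.1 hπ).2
  have hexp : Real.exp μ ≤ (2 : ℝ) ^ (7 * μ) := by
    rw [Real.rpow_def_of_pos two_pos]
    refine Real.exp_le_exp.2 ?_
    nlinarith [Real.log_two_gt_d9]
  rw [Real.rpow_add two_pos, Real.rpow_natCast] at markov
  rw [le_div_iff₀ (by positivity)]
  refine le_of_mul_le_mul_right ?_ (Real.exp_pos μ)
  refine le_trans ?_ markov
  calc (#T : ℝ) * 2 ^ m * Real.exp μ ≤ (#T : ℝ) * 2 ^ m * (2 : ℝ) ^ (7 * μ) := by gcongr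
    _ = _ := by ring

/-- Appending a suffix to a fixed prefix, as an embedding. -/
def appendEmbedding {r : ℕ} (c : ℕ) (x : Fin r → Bool) :
    (Fin c → Bool) ↪ (Fin (r + c) → Bool) where
  toFun z := Fin.append x z
  inj' z w h := by
    ext i
    simpa using congrFun h (Fin.natAdd r i)

theorem appendEmbedding_apply {r c : ℕ} (x : Fin r → Bool) (z : Fin c → Bool) :
    appendEmbedding c x z = Fin.append x z :=
  rfl

theorem mem_map_appendEmbedding {r c : ℕ} (x : Fin r → Bool) (w : Fin (r + c) → Bool) :
    w ∈ Finset.univ.map (appendEmbedding c x) ↔ (fun i => w (Fin.castAdd c i)) = x := by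
  simp only [Finset.mem_map, Finset.mem_univ, true_and, appendEmbedding_apply]
  constructor
  · rintro ⟨z, rfl⟩
    exact funext fun i => Fin.append_left x z i
  · rintro rfl
    exact ⟨fun i => w (Fin.natAdd r i), Fin.append_castAdd_natAdd⟩

/-- For positive `r, c` with `n = r + c`, the number of permutations
`π` of `n`-bit strings admitting `x₁, x₂ ∈ {0,1}^r` such that the number of suffixes
`z ∈ {0,1}^c` with `π(x₁ ∥ z)` beginning with `x₂` is at least
`7·(2^c·2^c/2^{r+c}) + 3(r+c)` is at most `(2^{r+c})!/2^{r+c}`; equivalently, a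
uniformly random permutation has this property with probability at most `2^{-(r+c)}`. -/
theorem perm_good_fraction (r c : ℕ) (hr : 0 < r) (hc : 0 < c) :
    (Nat.card {π : Equiv.Perm (Fin (r + c) → Bool) // ∃ x₁ x₂ : Fin r → Bool,
        7 * ((2 ^ c * 2 ^ c : ℝ) / 2 ^ (r + c)) + 3 * ((r : ℝ) + c)
          ≤ ((Finset.univ.filter fun z : Fin c → Bool =>
              (fun i : Fin r => π (Fin.append x₁ z) (Fin.castAdd c i)) = x₂).card : ℝ)} : ℝ)
      ≤ (Nat.factorial (2 ^ (r + c)) : ℝ) / 2 ^ (r + c) := by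
  classical
  set N : ℝ := (Nat.factorial (2 ^ (r + c)) : ℝ)
  have tail : ∀ x₁ x₂ : Fin r → Bool,
      ((Finset.univ.filter fun π : Equiv.Perm (Fin (r + c) → Bool) =>
        7 * ((2 ^ c * 2 ^ c : ℝ) / 2 ^ (r + c)) + 3 * ((r : ℝ) + c)
          ≤ ((Finset.univ.filter fun z : Fin c → Bool =>
              (fun i : Fin r => π (Fin.append x₁ z) (Fin.castAdd c i)) = x₂).card : ℝ)).card : ℝ)
      ≤ N / 2 ^ (3 * (r + c)) := by
    intro x₁ x₂
    have h := card_perm_le_card_filter_le (Finset.univ.map (appendEmbedding c x₁))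
      (Finset.univ.map (appendEmbedding c x₂)) (3 * (r + c))
    simp only [mem_map_appendEmbedding, Finset.filter_map, Finset.card_map, Finset.card_univ,
      Fintype.card_fun, Fintype.card_bool, Fintype.card_fin] at h
    push_cast at h
    exact h
  have union_bound : (Nat.card {π : Equiv.Perm (Fin (r + c) → Bool) // ∃ x₁ x₂ : Fin r → Bool,
        7 * ((2 ^ c * 2 ^ c : ℝ) / 2 ^ (r + c)) + 3 * ((r : ℝ) + c)
          ≤ ((Finset.univ.filter fun z : Fin c → Bool =>
              (fun i : Fin r => π (Fin.append x₁ z) (Fin.castAdd c i)) = x₂).card : ℝ)} : ℝ)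
      ≤ ∑ _p : (Fin r → Bool) × (Fin r → Bool), N / 2 ^ (3 * (r + c)) := by
    refine le_trans ?_ (Finset.sum_le_sum fun p _ => tail p.1 p.2)
    rw [Nat.card_eq_fintype_card, Fintype.card_subtype]
    norm_cast
    refine le_trans (Finset.card_le_card ?_) Finset.card_biUnion_le
    intro π hπ
    obtain ⟨x₁, x₂, h⟩ := (Finset.mem_filter.1 hπ).2
    refine Finset.mem_biUnion.2 ⟨(x₁, x₂), Finset.mem_univ _, ?_⟩
    exact Finset.mem_filter.2 ⟨Finset.mem_univ _, h⟩
  refine union_bound.trans ?_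
  rw [Finset.sum_const, nsmul_eq_mul, ← mul_div_assoc, div_le_div_iff₀ (by positivity)
    (by positivity)]
  simp only [Finset.card_univ, Fintype.card_prod, Fintype.card_fun, Fintype.card_bool,
    Fintype.card_fin]
  push_cast
  have hpow : (2 : ℝ) ^ r * 2 ^ r * 2 ^ (r + c) ≤ 2 ^ (3 * (r + c)) := by
    rw [← pow_add, ← pow_add]
    exact pow_le_pow_right₀ one_le_two (by omega)
  calc (2 : ℝ) ^ r * 2 ^ r * N * 2 ^ (r + c) = N * (2 ^ r * 2 ^ r * 2 ^ (r + c)) := by ring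
    _ ≤ N * 2 ^ (3 * (r + c)) := by gcongr
end

section
/- Fix positive integers r, c with n = r + c, M ∈ ℕ, and a permutation π of (Fin n → Bool) that is M-good. Let t ∈ ℕ, suppose (D_k, D_{k'}) is good with |D_k| ≤ t and |D_{k'}| ≤ t, and let x be a rate string with x ∉ D_k. Then the set B of capacity strings y causing a bad attach on x satisfies |B| ≤ (t + 1)·(t² + 2t)·M. -/
/-! Sponge databases, tails, intermediate pairs, and goodness (common setup). -/

/-- Rate strings. -/
abbrev RateStr (r : ℕ) := Fin r → Bool
/-- Capacity strings. -/
abbrev CapStr (c : ℕ) := Fin c → Bool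

/-- Bitwise XOR on capacity strings. -/
def capXor {c : ℕ} (a b : CapStr c) : CapStr c := fun i => xor (a i) (b i)

/-- The first `r` bits of an `(r+c)`-bit string. -/
def firstR {r c : ℕ} (w : Fin (r + c) → Bool) : RateStr r := fun i => w (Fin.castAdd c i)

/-- The last `c` bits of an `(r+c)`-bit string. -/
def lastC {r c : ℕ} (w : Fin (r + c) → Bool) : CapStr c := fun i => w (Fin.natAdd r i)

/-- A database: a finite partial function from rate strings to capacity strings. -/
abbrev Database (r c : ℕ) := RateStr r → Option (CapStr c)

/-- The number of inputs on which a database is defined. -/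
def dbSize {r c : ℕ} (D : Database r c) : ℕ :=
  (Finset.univ.filter fun x => (D x).isSome).card

/-- The relation "`z` has tail `s`" (with respect to `π`, `D_k`, `D_{k'}`). -/
inductive HasTail {r c : ℕ} (π : Equiv.Perm (Fin (r + c) → Bool))
    (Dk Dk' : Database r c) : CapStr c → List (RateStr r) → Prop
  | zero : HasTail π Dk Dk' (fun _ => false) []
  | step {zp : CapStr c} {s : List (RateStr r)} {xp : RateStr r} {yp yk : CapStr c} :
      HasTail π Dk Dk' zp s →
      Dk xp = some yp →
      Dk' (firstR (π (Fin.append xp (capXor zp yp)))) = some yk →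
      HasTail π Dk Dk'
        (capXor (lastC (π (Fin.append xp (capXor zp yp)))) yk) (s ++ [xp])

/-- "`z` has a tail". -/
def HasATail {r c : ℕ} (π : Equiv.Perm (Fin (r + c) → Bool))
    (Dk Dk' : Database r c) (z : CapStr c) : Prop :=
  ∃ s, HasTail π Dk Dk' z s

/-- `(x, z)` is an intermediate pair of `(D_k, D_{k'})`. -/
def IsIP {r c : ℕ} (π : Equiv.Perm (Fin (r + c) → Bool))
    (Dk Dk' : Database r c) (x : RateStr r) (z : CapStr c) : Prop :=
  ∃ (xp : RateStr r) (yp zp : CapStr c),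
    Dk xp = some yp ∧ HasATail π Dk Dk' zp ∧
    Fin.append x z = π (Fin.append xp (capXor zp yp))

/-- The pair `(D_k, D_{k'})` is good: every capacity string has at most one tail, and
distinct intermediate pairs have distinct first components. -/
def GoodDB {r c : ℕ} (π : Equiv.Perm (Fin (r + c) → Bool))
    (Dk Dk' : Database r c) : Prop :=
  (∀ z s₁ s₂, HasTail π Dk Dk' z s₁ → HasTail π Dk Dk' z s₂ → s₁ = s₂) ∧
  (∀ x z₁ z₂, IsIP π Dk Dk' x z₁ → IsIP π Dk Dk' x z₂ → z₁ = z₂)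

/-- `π` is `M`-good: for all rate strings `x₁, x₂`, the number of capacity strings `z`
with `π(x₁ ∥ z)` beginning with `x₂` is at most `M`. -/
def MGoodPerm {r c : ℕ} (π : Equiv.Perm (Fin (r + c) → Bool)) (M : ℕ) : Prop :=
  ∀ x₁ x₂ : RateStr r,
    Nat.card {z : CapStr c // firstR (π (Fin.append x₁ z)) = x₂} ≤ M

/-- `(x_i, z_i)` is one of the intermediate pairs of `(x, y)`:
there is a capacity string `z` with a tail such that `x_i ∥ z_i = π(x ∥ (z ⊕ y))`. -/
def IsIPxy {r c : ℕ} (π : Equiv.Perm (Fin (r + c) → Bool)) (Dk Dk' : Database r c)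
    (x : RateStr r) (y : CapStr c) (xi : RateStr r) (zi : CapStr c) : Prop :=
  ∃ z : CapStr c, HasATail π Dk Dk' z ∧
    Fin.append xi zi = π (Fin.append x (capXor z y))

/-- The image `y` causes a bad attach on preimage `x`: either some pair in
`IP_{(x,y)}` shares its first component with a pair in `IP(D_k, D_{k'})`, or some
pair in `IP_{(x,y)}` has its first component in `D_{k'}`. -/
def CausesBadAttach {r c : ℕ} (π : Equiv.Perm (Fin (r + c) → Bool))
    (Dk Dk' : Database r c) (x : RateStr r) (y : CapStr c) : Prop :=
  (∃ (x₁ : RateStr r) (z₁ z₂ : CapStr c),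
      IsIPxy π Dk Dk' x y x₁ z₁ ∧ IsIP π Dk Dk' x₁ z₂) ∨
  (∃ (x₁ : RateStr r) (z₁ : CapStr c),
      IsIPxy π Dk Dk' x y x₁ z₁ ∧ (Dk' x₁).isSome)

theorem firstR_append {r c : ℕ} (x : RateStr r) (z : CapStr c) :
    firstR (Fin.append x z) = x := by
  funext i
  simp [firstR]

theorem append_firstR_lastC {r c : ℕ} (w : Fin (r + c) → Bool) :
    Fin.append (firstR w) (lastC w) = w :=
  Fin.append_castAdd_natAdd

theorem capXor_capXor_cancel {c : ℕ} (a b : CapStr c) : capXor a (capXor a b) = b := by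
  funext i
  simp [capXor]

open Classical in
/-- A good pair of databases has at most `|D_{k'}| + 1` capacity strings with a tail. -/
theorem card_hasATail_le {r c : ℕ} {π : Equiv.Perm (Fin (r + c) → Bool)}
    {Dk Dk' : Database r c} (hgood : GoodDB π Dk Dk') :
    (Finset.univ.filter fun z => HasATail π Dk Dk' z).card ≤ dbSize Dk' + 1 := by
  let f : RateStr r → CapStr c := fun x =>
    if h : ∃ z, IsIP π Dk Dk' x z then
      capXor h.choose ((Dk' x).getD (fun _ => false)) else fun _ => false
  have hsub : (Finset.univ.filter fun z => HasATail π Dk Dk' z) ⊆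
      insert (fun _ => false) ((Finset.univ.filter fun x => (Dk' x).isSome).image f) := by
    intro z hz
    obtain ⟨s, hs⟩ := (Finset.mem_filter.mp hz).2
    cases hs with
    | zero => exact Finset.mem_insert_self _ _
    | @step zp s xp yp yk htail hxp hyk =>
      refine Finset.mem_insert_of_mem (Finset.mem_image.mpr
        ⟨firstR (π (Fin.append xp (capXor zp yp))), by simp [hyk], ?_⟩)
      have hip : IsIP π Dk Dk' (firstR (π (Fin.append xp (capXor zp yp))))
          (lastC (π (Fin.append xp (capXor zp yp)))) :=
        ⟨xp, yp, zp, hxp, ⟨s, htail⟩, append_firstR_lastC _⟩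
      have hex : ∃ z, IsIP π Dk Dk' (firstR (π (Fin.append xp (capXor zp yp)))) z := ⟨_, hip⟩
      simp only [f, dif_pos hex, hyk, Option.getD_some]
      rw [hgood.2 _ _ _ hex.choose_spec hip]
  exact (Finset.card_le_card hsub).trans ((Finset.card_insert_le _ _).trans
    (Nat.add_le_add_right Finset.card_image_le 1))

open Classical in
/-- Every intermediate pair is determined by an entry of `D_k` and a capacity string with a
tail. -/
theorem card_isIP_fst_le {r c : ℕ} (π : Equiv.Perm (Fin (r + c) → Bool))
    (Dk Dk' : Database r c) :
    (Finset.univ.filter fun x => ∃ z, IsIP π Dk Dk' x z).card ≤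
      dbSize Dk * (Finset.univ.filter fun z => HasATail π Dk Dk' z).card := by
  have hsub : (Finset.univ.filter fun x => ∃ z, IsIP π Dk Dk' x z) ⊆
      ((Finset.univ.filter fun x => (Dk x).isSome) ×ˢ
        (Finset.univ.filter fun z => HasATail π Dk Dk' z)).image fun p =>
          firstR (π (Fin.append p.1 (capXor p.2 ((Dk p.1).getD fun _ => false)))) := by
    intro x hx
    obtain ⟨z, xp, yp, zp, hxp, hzp, heq⟩ := (Finset.mem_filter.mp hx).2
    refine Finset.mem_image.mpr ⟨(xp, zp), by simp [hxp, hzp], ?_⟩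
    simp only [hxp, Option.getD_some]
    rw [← heq, firstR_append]
  refine (Finset.card_le_card hsub).trans (Finset.card_image_le.trans ?_)
  rw [Finset.card_product, dbSize]

open Classical in
theorem MGoodPerm.card_xor_le {r c M : ℕ} {π : Equiv.Perm (Fin (r + c) → Bool)}
    (hπ : MGoodPerm π M) (x₁ x₂ : RateStr r) (z : CapStr c) :
    (Finset.univ.filter fun y => firstR (π (Fin.append x₁ (capXor z y))) = x₂).card ≤ M := by
  refine le_trans ?_ (hπ x₁ x₂)
  rw [Nat.card_eq_fintype_card, Fintype.card_subtype]
  refine Finset.card_le_card_of_injOn (capXor z) (fun y hy => by simpa using hy) ?_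
  intro a _ b _ hab
  rw [← capXor_capXor_cancel z a, hab, capXor_capXor_cancel]

/-- For an `M`-good `π` and a good database pair with at most `t`
entries each, and any `x ∉ D_k`, at most `(t+1)·(t²+2t)·M` images `y` cause a bad
attach on `x`. -/
theorem few_bad_attach (r c : ℕ) (hr : 0 < r) (hc : 0 < c) (M : ℕ)
    (π : Equiv.Perm (Fin (r + c) → Bool)) (hπ : MGoodPerm π M)
    (Dk Dk' : Database r c) (t : ℕ)
    (hgood : GoodDB π Dk Dk') (hk : dbSize Dk ≤ t) (hk' : dbSize Dk' ≤ t)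
    (x : RateStr r) (hx : Dk x = none) :
    Nat.card {y : CapStr c // CausesBadAttach π Dk Dk' x y}
      ≤ (t + 1) * (t ^ 2 + 2 * t) * M := by
  classical
  let T := Finset.univ.filter fun z => HasATail π Dk Dk' z
  let X := (Finset.univ.filter fun x => ∃ z, IsIP π Dk Dk' x z) ∪
    Finset.univ.filter fun x => (Dk' x).isSome
  have hT : T.card ≤ t + 1 := (card_hasATail_le hgood).trans (Nat.add_le_add_right hk' 1)
  have hX : X.card ≤ t ^ 2 + 2 * t := by
    calc X.card ≤ dbSize Dk * T.card + dbSize Dk' :=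
          (Finset.card_union_le _ _).trans
            (Nat.add_le_add_right (card_isIP_fst_le π Dk Dk') _)
      _ ≤ t * (t + 1) + t := Nat.add_le_add (Nat.mul_le_mul hk hT) hk'
      _ = t ^ 2 + 2 * t := by ring
  have hsub : (Finset.univ.filter fun y => CausesBadAttach π Dk Dk' x y) ⊆
      (T ×ˢ X).biUnion fun p =>
        Finset.univ.filter fun y => firstR (π (Fin.append x (capXor p.1 y))) = p.2 := by
    intro y hy
    obtain ⟨x₁, z₁, ⟨z, hz, heq⟩, hx₁⟩ : ∃ x₁ z₁, IsIPxy π Dk Dk' x y x₁ z₁ ∧ x₁ ∈ X := by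
      rcases (Finset.mem_filter.mp hy).2 with ⟨x₁, z₁, z₂, h, hip⟩ | ⟨x₁, z₁, h, hsome⟩
      · exact ⟨x₁, z₁, h, Finset.mem_union_left _ (by simpa using ⟨z₂, hip⟩)⟩
      · exact ⟨x₁, z₁, h, Finset.mem_union_right _ (by simpa using hsome)⟩
    refine Finset.mem_biUnion.mpr
      ⟨(z, x₁), Finset.mem_product.mpr ⟨by simpa [T] using hz, hx₁⟩, ?_⟩
    simp [← heq, firstR_append]
  rw [Nat.card_eq_fintype_card, Fintype.card_subtype]
  refine (Finset.card_le_card hsub).trans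
    ((Finset.card_biUnion_le_card_mul _ _ M fun p _ => hπ.card_xor_le x p.2 p.1).trans ?_)
  rw [Finset.card_product]
  exact Nat.mul_le_mul_right M (Nat.mul_le_mul hT hX)
end
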